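/- Let Ω be an open subset of ℝ^n closed under addition (x, y ∈ Ω implies x + y ∈ Ω), and let f : Ω → ℂ be a non-trivial locally integrable function satisfying f(x)·f(y) = f(x+y) for almost every (x,y) ∈ Ω × Ω. Then there exists a vector b ∈ ℂ^n such that f(x) = exp(b · x) for almost every x ∈ Ω. -/

import Mathlib

open MeasureTheory Complex

/-- A function multiplicative on an additively closed set sends positive multiples to powers. -/
theorem map_nsmul_of_map_add {E R : Type*} [AddMonoid E] [Monoid R] {Ω : Set E}
    (hadd : ∀ x ∈ Ω, ∀ y ∈ Ω, x + y ∈ Ω) {g : E → R}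
    (hg : ∀ x ∈ Ω, ∀ y ∈ Ω, g x * g y = g (x + y)) {y : E} (hy : y ∈ Ω) (N : ℕ) :
    (N + 1) • y ∈ Ω ∧ g ((N + 1) • y) = g y ^ (N + 1) := by
  induction N with
  | zero => simpa using hy
  | succ N ih =>
    rw [succ_nsmul]
    exact ⟨hadd _ ih.1 _ hy, by rw [← hg _ ih.1 _ hy, ih.2, ← pow_succ]⟩

section
variable {E : Type*} [NormedAddCommGroup E] [NormedSpace ℝ E]

/-- A multiplicative function on an additively closed open set, differentiable and nonzero at some
point `s`, is the exponential of its logarithmic derivative at `s`. -/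
theorem eq_exp_fderiv_of_map_add {Ω : Set E} (hΩ : IsOpen Ω)
    (hadd : ∀ x ∈ Ω, ∀ y ∈ Ω, x + y ∈ Ω) {g : E → ℂ}
    (hg : ∀ x ∈ Ω, ∀ y ∈ Ω, g x * g y = g (x + y)) {s : E} (hs : s ∈ Ω) (hgs : g s ≠ 0)
    {L : E →L[ℝ] ℂ} (hL : HasFDerivAt g L s) {x : E} (hx : x ∈ Ω) :
    g x = exp (L x / g s) := by
  have hlim : Filter.Tendsto (fun N : ℕ ↦ (N : ℂ) * (g (s + (N : ℝ)⁻¹ • x) / g s - 1))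
      Filter.atTop (nhds (L x / g s)) := by
    have h := hL.lim x (c := fun N : ℕ ↦ (N : ℝ)) (l := Filter.atTop)
      (by simpa using tendsto_natCast_atTop_atTop (R := ℝ))
    refine (h.div_const (g s)).congr fun N ↦ ?_
    simp only [real_smul, ofReal_natCast]
    field_simp
  have hpow := tendsto_one_add_pow_exp_of_tendsto hlim
  refine tendsto_nhds_unique (tendsto_const_nhds.congr' ?_) hpow
  have hmem : ∀ᶠ N : ℕ in Filter.atTop, s + (N : ℝ)⁻¹ • x ∈ Ω := by
    have : Filter.Tendsto (fun N : ℕ ↦ s + (N : ℝ)⁻¹ • x) Filter.atTop (nhds s) := by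
      simpa using ((tendsto_inv_atTop_nhds_zero_nat (𝕜 := ℝ)).smul_const x).const_add s
    exact this.eventually (hΩ.mem_nhds hs)
  filter_upwards [hmem, Filter.eventually_ge_atTop 1] with N hN hN1
  obtain ⟨M, rfl⟩ : ∃ M, N = M + 1 := ⟨N - 1, by omega⟩
  have h1 := map_nsmul_of_map_add hadd hg hN M
  have h2 := map_nsmul_of_map_add hadd hg hs M
  have h3 : (M + 1) • (s + ((M + 1 : ℕ) : ℝ)⁻¹ • x) = (M + 1) • s + x := by
    rw [nsmul_add, ← Nat.cast_smul_eq_nsmul ℝ (M + 1) (((M + 1 : ℕ) : ℝ)⁻¹ • x), smul_smul,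
      mul_inv_cancel₀ (by positivity), one_smul]
  rw [h3, ← hg _ h2.1 _ hx, h2.2] at h1
  rw [add_sub_cancel, div_pow, ← h1.2]
  field_simp

variable [FiniteDimensional ℝ E] [MeasurableSpace E] [BorelSpace E]
  {μ : Measure E} [μ.IsAddHaarMeasure]

/-- Mollifying a function locally integrable on `Ω` gives a differentiable function wherever the
translated support of the mollifier lies in `Ω`. -/
theorem differentiableAt_integral_smul_comp_add {Ω : Set E} (hΩ : IsOpen Ω) {f : E → ℂ}
    (hloc : LocallyIntegrableOn f Ω μ) {φ : E → ℝ} (hφ : ContDiff ℝ 1 φ)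
    (hc : HasCompactSupport φ) {x₀ : E} (hx₀ : ∀ y ∈ tsupport φ, x₀ + y ∈ Ω) :
    DifferentiableAt ℝ (fun x ↦ ∫ y, φ y • f (x + y) ∂μ) x₀ := by
  have hK : IsCompact ((fun y ↦ x₀ + y) '' tsupport φ) :=
    IsCompact.image hc (by fun_prop)
  obtain ⟨K', hK', hKK', hK'Ω⟩ := exists_compact_between hK hΩ
    (by rintro _ ⟨y, hy, rfl⟩; exact hx₀ y hy)
  obtain ⟨δ, hδ, hδK⟩ := hK.exists_thickening_subset_open isOpen_interior hKK'
  have hint : IntegrableOn f K' μ := hloc.integrableOn_compact_subset hK'Ω hK'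
  have hint' : LocallyIntegrable (K'.indicator f) μ :=
    (hint.integrable_indicator hK'.measurableSet).locallyIntegrable
  have hconv : ContDiff ℝ 1 (convolution (fun y ↦ φ (-y)) (K'.indicator f)
      (ContinuousLinearMap.lsmul ℝ ℝ) μ) :=
    HasCompactSupport.contDiff_convolution_left _
      (hc.comp_homeomorph (Homeomorph.neg E)) (hφ.comp contDiff_neg) hint'
  refine (hconv.differentiable (by norm_num) x₀).congr_of_eventuallyEq ?_
  filter_upwards [Metric.ball_mem_nhds x₀ hδ] with x hx
  symm
  rw [convolution_lsmul, ← integral_neg_eq_self]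
  refine integral_congr_ae (.of_forall fun y ↦ ?_)
  simp only [neg_neg, sub_neg_eq_add]
  by_cases hy : y ∈ tsupport φ
  · rw [Set.indicator_of_mem]
    refine interior_subset (hδK (Metric.mem_thickening_iff.2 ⟨x₀ + y, ⟨y, hy, rfl⟩, ?_⟩))
    simpa using hx
  · simp [image_eq_zero_of_notMem_tsupport hy]

/-- A nontrivial locally integrable a.e. solution of the multiplicative Cauchy equation agrees a.e.
with a differentiable solution for which the equation holds everywhere. -/
theorem exists_differentiable_map_add {Ω : Set E} (hΩ : IsOpen Ω)
    (hadd : ∀ x ∈ Ω, ∀ y ∈ Ω, x + y ∈ Ω) {f : E → ℂ}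
    (hloc : LocallyIntegrableOn f Ω μ)
    (hnontriv : ¬ (∀ᵐ x ∂(μ.restrict Ω), f x = 0))
    (heq : ∀ᵐ p ∂((μ.restrict Ω).prod (μ.restrict Ω)), f p.1 * f p.2 = f (p.1 + p.2)) :
    ∃ g : E → ℂ, (∀ x ∈ Ω, DifferentiableAt ℝ g x) ∧ (∀ᵐ x ∂(μ.restrict Ω), f x = g x) ∧
      ∀ x ∈ Ω, ∀ y ∈ Ω, g x * g y = g (x + y) := by
  obtain ⟨φ, hφ, hc, hsupp, hne⟩ : ∃ φ : E → ℝ, ContDiff ℝ 1 φ ∧ HasCompactSupport φ ∧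
      tsupport φ ⊆ Ω ∧ ∫ y, φ y • f y ∂μ ≠ 0 := by
    by_contra! h
    refine hnontriv ((ae_restrict_iff' hΩ.measurableSet).2 ?_)
    exact hΩ.ae_eq_zero_of_integral_contDiff_smul_eq_zero hloc fun φ hφ hc hsupp ↦
      h φ (hφ.of_le (by exact_mod_cast le_top)) hc hsupp
  have hae := Measure.ae_ae_of_ae_prod heq
  set c := ∫ y, φ y • f y ∂μ
  set g : E → ℂ := fun x ↦ (∫ y, φ y • f (x + y) ∂μ) / c with hgdef
  have hdiff : ∀ x ∈ Ω, DifferentiableAt ℝ g x := fun x hx ↦ by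
    simpa only [hgdef, div_eq_mul_inv] using (differentiableAt_integral_smul_comp_add hΩ hloc hφ hc
      fun y hy ↦ hadd x hx y (hsupp hy)).mul_const c⁻¹
  have hcont : ContinuousOn g Ω := fun x hx ↦ (hdiff x hx).continuousAt.continuousWithinAt
  have hfg : ∀ᵐ x ∂(μ.restrict Ω), f x = g x := by
    filter_upwards [hae] with x hx
    rw [hgdef, eq_div_iff hne, ← integral_const_mul]
    refine integral_congr_ae ?_
    filter_upwards [(ae_restrict_iff' hΩ.measurableSet).1 hx] with y hy
    by_cases hyΩ : y ∈ Ω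
    · simp only [← hy hyΩ, real_smul]; ring
    · simp [image_eq_zero_of_notMem_tsupport fun h ↦ hyΩ (hsupp h)]
  have hright : ∀ᵐ x ∂(μ.restrict Ω), ∀ y ∈ Ω, g x * g y = g (x + y) := by
    filter_upwards [hae, hfg, ae_restrict_mem hΩ.measurableSet] with x hx hxg hxΩ
    refine Measure.eqOn_open_of_ae_eq (μ := μ) ?_ hΩ (continuousOn_const.mul hcont)
      (hcont.comp (by fun_prop) fun y hy ↦ hadd x hxΩ y hy)
    have htrans : ∀ᵐ y ∂μ, x + y ∈ Ω → f (x + y) = g (x + y) :=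
      (measurePreserving_add_left μ x).quasiMeasurePreserving.ae
        ((ae_restrict_iff' hΩ.measurableSet).1 hfg)
    filter_upwards [hx, hfg, ae_restrict_of_ae htrans, ae_restrict_mem hΩ.measurableSet]
      with y h1 h2 h3 hyΩ
    rw [← hxg, ← h2, h1, h3 (hadd x hxΩ y hyΩ)]
  refine ⟨g, hdiff, hfg, fun x hx y hy ↦ ?_⟩
  refine Measure.eqOn_open_of_ae_eq (μ := μ) (f := fun x ↦ g x * g y)
    (g := fun x ↦ g (x + y)) ?_ hΩ (hcont.mul continuousOn_const)
    (hcont.comp (by fun_prop) fun x hx ↦ hadd x hx y hy) hx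
  filter_upwards [hright] with x hx using hx y hy

end

theorem cauchy_exponential_equation (n : ℕ)
    (Ω : Set (EuclideanSpace ℝ (Fin n))) (hΩ : IsOpen Ω)
    (hadd : ∀ x ∈ Ω, ∀ y ∈ Ω, x + y ∈ Ω)
    (f : EuclideanSpace ℝ (Fin n) → ℂ)
    (hloc : LocallyIntegrableOn f Ω volume)
    (hnontriv : ¬ (∀ᵐ x ∂(volume.restrict Ω), f x = 0))
    (heq : ∀ᵐ p ∂((volume.restrict Ω).prod (volume.restrict Ω)),
      f p.1 * f p.2 = f (p.1 + p.2)) :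
    ∃ b : Fin n → ℂ, ∀ᵐ x ∂(volume.restrict Ω),
      f x = Complex.exp (∑ i, b i * (x i)) := by
  obtain ⟨g, hdiff, hfg, hg⟩ := exists_differentiable_map_add hΩ hadd hloc hnontriv heq
  obtain ⟨s, hs, hgs⟩ : ∃ s ∈ Ω, g s ≠ 0 := by
    by_contra! h
    refine hnontriv ?_
    filter_upwards [hfg, ae_restrict_mem hΩ.measurableSet] with x hx hxΩ
    rw [hx, h x hxΩ]
  refine ⟨fun i ↦ fderiv ℝ g s (EuclideanSpace.single i 1) / g s, ?_⟩
  filter_upwards [hfg, ae_restrict_mem hΩ.measurableSet] with x hx hxΩ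
  rw [hx, eq_exp_fderiv_of_map_add hΩ hadd hg hs hgs (hdiff s hs).hasFDerivAt hxΩ]
  congr 1
  have hsum : x = ∑ i, x i • EuclideanSpace.single i (1 : ℝ) := by
    simpa using ((EuclideanSpace.basisFun (Fin n) ℝ).sum_repr x).symm
  conv_lhs => rw [hsum, map_sum, Finset.sum_div]
  refine Finset.sum_congr rfl fun i _ ↦ ?_
  rw [map_smul, real_smul]
  ring
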